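/- Let (X, d) be a metric space with d ≤ 1. Adjoin a new point * with d(x, *) = 1 for all x ∈ X. Then the function on the real vector space L(X) with Hamel basis X ∪ {*}, defined by ‖x‖ = inf of Σᵢ |λᵢ| d(xᵢ, yᵢ) over all representations x = Σᵢ λᵢ xᵢ with Σᵢ λᵢ yᵢ ∈ Span{*}, is a norm on L(X). -/

import Mathlib

noncomputable section

/-- The metric on `X ⊔ {*}` (with `none` playing the role of the basepoint `*`),
where the new point `*` is at distance `1` from every point of `X`. -/
def optDist (X : Type) [MetricSpace X] : Option X → Option X → ℝ
  | some x, some y => dist x y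
  | none, none => 0
  | _, _ => 1

/-- The candidate norm on the free real vector space `L(X)` with Hamel basis `X ⊔ {*}`
(realized as finitely supported functions `Option X →₀ ℝ`): the infimum of
`∑ᵢ |λᵢ| d(xᵢ, yᵢ)` over all representations `∑ᵢ λᵢ xᵢ = w` with
`∑ᵢ λᵢ yᵢ ∈ Span{*}`. -/
def freeNorm (X : Type) [MetricSpace X] (w : Option X →₀ ℝ) : ℝ :=
  sInf { r : ℝ | ∃ (n : ℕ) (lam : Fin n → ℝ) (a b : Fin n → Option X),
    (∑ i, lam i • Finsupp.single (a i) (1 : ℝ)) = w ∧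
    (∃ c : ℝ, (∑ i, lam i • Finsupp.single (b i) (1 : ℝ)) =
        c • Finsupp.single (none : Option X) (1 : ℝ)) ∧
    r = ∑ i, |lam i| * optDist X (a i) (b i) }

/-- The set of costs of the representations of `w`, whose infimum is `freeNorm X w`. -/
def representationCosts (X : Type) [MetricSpace X] (w : Option X →₀ ℝ) : Set ℝ :=
  { r : ℝ | ∃ (n : ℕ) (lam : Fin n → ℝ) (a b : Fin n → Option X),
    (∑ i, lam i • Finsupp.single (a i) (1 : ℝ)) = w ∧
    (∃ c : ℝ, (∑ i, lam i • Finsupp.single (b i) (1 : ℝ)) =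
        c • Finsupp.single (none : Option X) (1 : ℝ)) ∧
    r = ∑ i, |lam i| * optDist X (a i) (b i) }

section

variable {X : Type} [MetricSpace X]

theorem freeNorm_eq_sInf (w : Option X →₀ ℝ) :
    freeNorm X w = sInf (representationCosts X w) := rfl

theorem optDist_nonneg (a b : Option X) : 0 ≤ optDist X a b := by
  cases a <;> cases b <;> simp [optDist]

theorem nonneg_of_mem_representationCosts {w : Option X →₀ ℝ} {r : ℝ}
    (hr : r ∈ representationCosts X w) : 0 ≤ r := by
  obtain ⟨n, lam, a, b, -, -, rfl⟩ := hr
  exact Finset.sum_nonneg fun i _ => mul_nonneg (abs_nonneg _) (optDist_nonneg _ _)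

theorem bddBelow_representationCosts (w : Option X →₀ ℝ) :
    BddBelow (representationCosts X w) :=
  ⟨0, fun _ => nonneg_of_mem_representationCosts⟩

theorem add_mem_representationCosts {w v : Option X →₀ ℝ} {r s : ℝ}
    (hr : r ∈ representationCosts X w) (hs : s ∈ representationCosts X v) :
    r + s ∈ representationCosts X (w + v) := by
  obtain ⟨n, lam, a, b, rfl, ⟨c, hc⟩, rfl⟩ := hr
  obtain ⟨m, mu, a', b', rfl, ⟨c', hc'⟩, rfl⟩ := hs
  refine ⟨n + m, Fin.append lam mu, Fin.append a a', Fin.append b b', ?_, ⟨c + c', ?_⟩, ?_⟩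
  · simp only [Fin.sum_univ_add, Fin.append_left, Fin.append_right]
  · simp only [Fin.sum_univ_add, Fin.append_left, Fin.append_right, hc, hc', add_smul]
  · simp only [Fin.sum_univ_add, Fin.append_left, Fin.append_right]

theorem mul_mem_representationCosts (c : ℝ) {w : Option X →₀ ℝ} {r : ℝ}
    (hr : r ∈ representationCosts X w) : |c| * r ∈ representationCosts X (c • w) := by
  obtain ⟨n, lam, a, b, rfl, ⟨e, he⟩, rfl⟩ := hr
  refine ⟨n, fun i => c * lam i, a, b, ?_, ⟨c * e, ?_⟩, ?_⟩
  · simp only [mul_smul, Finset.smul_sum]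
  · simp only [mul_smul, ← Finset.smul_sum, he]
  · simp only [abs_mul, mul_assoc, Finset.mul_sum]

theorem mul_optDist_none_mem_representationCosts (t : ℝ) (a : Option X) :
    |t| * optDist X a none ∈ representationCosts X (Finsupp.single a t) :=
  ⟨1, fun _ => t, fun _ => a, fun _ => none, by simp, ⟨t, by simp⟩, by simp⟩

theorem representationCosts_nonempty (w : Option X →₀ ℝ) :
    (representationCosts X w).Nonempty := by
  induction w using Finsupp.induction_linear with
  | zero =>
    rw [← Finsupp.single_zero none]
    exact ⟨_, mul_optDist_none_mem_representationCosts 0 none⟩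
  | add w v hw hv =>
    obtain ⟨r, hr⟩ := hw
    obtain ⟨s, hs⟩ := hv
    exact ⟨r + s, add_mem_representationCosts hr hs⟩
  | single a t => exact ⟨_, mul_optDist_none_mem_representationCosts t a⟩

theorem freeNorm_nonneg (w : Option X →₀ ℝ) : 0 ≤ freeNorm X w :=
  Real.sInf_nonneg fun _ => nonneg_of_mem_representationCosts

theorem freeNorm_add_le (w v : Option X →₀ ℝ) :
    freeNorm X (w + v) ≤ freeNorm X w + freeNorm X v := by
  refine le_of_forall_pos_le_add fun ε hε => ?_
  obtain ⟨r, hr, hr'⟩ := Real.lt_sInf_add_pos (representationCosts_nonempty w) (half_pos hε)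
  obtain ⟨s, hs, hs'⟩ := Real.lt_sInf_add_pos (representationCosts_nonempty v) (half_pos hε)
  have := csInf_le (bddBelow_representationCosts _) (add_mem_representationCosts hr hs)
  simp only [freeNorm_eq_sInf]
  linarith

theorem freeNorm_single_none (t : ℝ) : freeNorm X (Finsupp.single none t) = 0 := by
  have h := mul_optDist_none_mem_representationCosts (X := X) t none
  simp only [optDist, mul_zero] at h
  exact le_antisymm (csInf_le (bddBelow_representationCosts _) h) (freeNorm_nonneg _)

theorem freeNorm_smul_le (c : ℝ) (w : Option X →₀ ℝ) :
    freeNorm X (c • w) ≤ |c| * freeNorm X w := by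
  rw [freeNorm_eq_sInf w, ← smul_eq_mul, ← Real.sInf_smul_of_nonneg (abs_nonneg c)]
  refine le_csInf (representationCosts_nonempty w).smul_set ?_
  rintro _ ⟨r, hr, rfl⟩
  exact csInf_le (bddBelow_representationCosts _) (mul_mem_representationCosts c hr)

theorem freeNorm_smul (c : ℝ) (w : Option X →₀ ℝ) :
    freeNorm X (c • w) = |c| * freeNorm X w := by
  rcases eq_or_ne c 0 with rfl | hc
  · simpa using freeNorm_single_none (X := X) 0
  · refine le_antisymm (freeNorm_smul_le c w) ?_
    have h := freeNorm_smul_le c⁻¹ (c • w)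
    rwa [inv_smul_smul₀ hc, abs_inv, ← div_eq_inv_mul, le_div_iff₀' (abs_pos.mpr hc)] at h

/-- A function vanishing at the basepoint and `1`-Lipschitz for `optDist` bounds `freeNorm`
from below by duality. -/
theorem abs_linearCombination_le_freeNorm {f : Option X → ℝ} (hf₀ : f none = 0)
    (hf : ∀ a b, |f a - f b| ≤ optDist X a b) (w : Option X →₀ ℝ) :
    |Finsupp.linearCombination ℝ f w| ≤ freeNorm X w := by
  refine le_csInf (representationCosts_nonempty w) ?_
  rintro _ ⟨n, lam, a, b, rfl, ⟨c, hc⟩, rfl⟩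
  have hb : ∑ i, lam i * f (b i) = 0 := by
    simpa [hf₀] using congrArg (Finsupp.linearCombination ℝ f) hc
  calc |Finsupp.linearCombination ℝ f (∑ i, lam i • Finsupp.single (a i) (1 : ℝ))|
      = |∑ i, lam i * (f (a i) - f (b i))| := by
        simp [mul_sub, Finset.sum_sub_distrib, hb]
    _ ≤ ∑ i, |lam i * (f (a i) - f (b i))| := Finset.abs_sum_le_sum_abs _ _
    _ ≤ ∑ i, |lam i| * optDist X (a i) (b i) := by
        gcongr with i
        rw [abs_mul]
        gcongr
        exact hf _ _

/-- The tent function of height and radius `ε` around `x`, extended by `0` to the basepoint. -/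
def tent (x : X) (ε : ℝ) (a : Option X) : ℝ := a.elim 0 fun y => max 0 (ε - dist y x)

theorem abs_tent_sub_tent_le (x : X) {ε : ℝ} (hε : ε ≤ 1) (a b : Option X) :
    |tent x ε a - tent x ε b| ≤ optDist X a b := by
  have h (y : X) : |max 0 (ε - dist y x)| ≤ 1 := by
    rw [abs_of_nonneg (le_max_left _ _)]
    exact max_le zero_le_one (by linarith [dist_nonneg (x := y) (y := x)])
  match a, b with
  | none, none => simp [tent, optDist]
  | some y, none => simpa [tent, optDist] using h y
  | none, some y => simpa [tent, optDist] using h y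
  | some y, some z =>
    refine (abs_max_sub_max_le_max 0 (ε - dist y x) 0 (ε - dist z x)).trans ?_
    rw [sub_self, abs_zero, sub_sub_sub_cancel_left, abs_sub_comm]
    exact max_le dist_nonneg (abs_dist_sub_le y z x)

theorem exists_pos_le_dist_of_finset (x : X) (s : Finset X) :
    ∃ ε > 0, ε ≤ 1 ∧ ∀ y ∈ s, y ≠ x → ε ≤ dist y x := by
  induction s using Finset.cons_induction with
  | empty => exact ⟨1, one_pos, le_rfl, by simp⟩
  | cons z s _ ih =>
    obtain ⟨ε, hε, hε₁, h⟩ := ih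
    rcases eq_or_ne z x with rfl | hz
    · refine ⟨ε, hε, hε₁, fun y hy hyz => h y ?_ hyz⟩
      exact (Finset.mem_cons.mp hy).resolve_left hyz
    · refine ⟨min ε (dist z x), lt_min hε (dist_pos.mpr hz), (min_le_left _ _).trans hε₁, ?_⟩
      intro y hy hyx
      rcases Finset.mem_cons.mp hy with rfl | hy
      · exact min_le_right _ _
      · exact (min_le_left _ _).trans (h y hy hyx)

theorem freeNorm_pos {w : Option X →₀ ℝ} {x : X} (hx : w (some x) ≠ 0) :
    0 < freeNorm X w := by
  obtain ⟨ε, hε, hε₁, h⟩ := exists_pos_le_dist_of_finset x w.support.eraseNone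
  have key : Finsupp.linearCombination ℝ (tent x ε) w = w (some x) * ε := by
    rw [Finsupp.linearCombination_apply, Finsupp.sum, Finset.sum_eq_single (some x)]
    · simp [tent, hε.le]
    · rintro (_ | y) hy hyx
      · simp [tent]
      · have := h y (Finset.mem_eraseNone.mpr hy) (by simpa using hyx)
        simp [tent, this]
    · intro hw
      simp [Finsupp.notMem_support_iff.mp hw]
  refine lt_of_lt_of_le ?_ (abs_linearCombination_le_freeNorm rfl (abs_tent_sub_tent_le x hε₁) w)
  rw [key]
  exact abs_pos.mpr (mul_ne_zero hx hε.ne')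

theorem freeNorm_eq_zero_iff (w : Option X →₀ ℝ) :
    freeNorm X w = 0 ↔ w ∈ Submodule.span ℝ {Finsupp.single (none : Option X) (1 : ℝ)} := by
  rw [Submodule.mem_span_singleton]
  constructor
  · intro h
    refine ⟨w none, ?_⟩
    ext (_ | x)
    · simp
    · by_contra hx
      exact (freeNorm_pos (x := x) fun h0 => hx (by simp [h0])).ne' h
  · rintro ⟨t, rfl⟩
    simpa using freeNorm_single_none (X := X) t

end

/-- if `d ≤ 1` on `X`, then `freeNorm` is a norm on `L(X)`:
it is nonnegative, absolutely homogeneous, subadditive, and definite in the sense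
of the free space construction (where the basepoint `*` is identified with `0`):
its kernel is exactly `Span{*}`. -/
theorem freeNorm_is_norm (X : Type) [MetricSpace X]
    (hd : ∀ x y : X, dist x y ≤ 1) :
    (∀ w : Option X →₀ ℝ, 0 ≤ freeNorm X w) ∧
    (∀ w : Option X →₀ ℝ, freeNorm X w = 0 ↔
      w ∈ Submodule.span ℝ {Finsupp.single (none : Option X) (1 : ℝ)}) ∧
    (∀ (c : ℝ) (w : Option X →₀ ℝ), freeNorm X (c • w) = |c| * freeNorm X w) ∧
    (∀ w v : Option X →₀ ℝ, freeNorm X (w + v) ≤ freeNorm X w + freeNorm X v) := by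
  exact ⟨freeNorm_nonneg, freeNorm_eq_zero_iff, freeNorm_smul, freeNorm_add_le⟩
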